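/- Bulk limit for class AII†: fix ρ with 0 ≤ ρ < 1, y ∈ ℝ and c ∈ ℂ, and set x_N := N·ρ + √N·y + c. Then lim_{N→∞} (N!/(2N)!) · ∑_{j=0}^{N} ((2j)!/j!) · (4 x_N)^{N−j} · e^{−2x_N} · E_{2j}(2 x_N) = 1/(1 − ρ). -/

import Mathlib

open Filter Finset

/-- The truncated exponential `E_n(x) = ∑_{j=0}^n x^j/j!`. -/
noncomputable def truncExp (n : ℕ) (x : ℂ) : ℂ :=
  ∑ j ∈ Finset.range (n + 1), x ^ j / (Nat.factorial j : ℂ)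

/-- The real truncated exponential. -/
noncomputable def realTruncExp (n : ℕ) (u : ℝ) : ℝ :=
  ∑ j ∈ Finset.range (n + 1), u ^ j / (Nat.factorial j : ℝ)

lemma realTruncExp_nonneg (n : ℕ) {u : ℝ} (hu : 0 ≤ u) : 0 ≤ realTruncExp n u :=
  Finset.sum_nonneg fun _ _ => by positivity

lemma realTruncExp_le_exp (n : ℕ) {u : ℝ} (hu : 0 ≤ u) : realTruncExp n u ≤ Real.exp u :=
  Real.sum_le_exp_of_nonneg hu _

lemma realTruncExp_le_succ (n : ℕ) {u : ℝ} (hu : 0 ≤ u) :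
    realTruncExp n u ≤ realTruncExp (n + 1) u := by
  unfold realTruncExp
  rw [Finset.sum_range_succ _ (n + 1)]
  have : 0 ≤ u ^ (n + 1) / (Nat.factorial (n + 1) : ℝ) := by positivity
  linarith

lemma mul_realTruncExp_le (n : ℕ) {u : ℝ} (hu : 0 ≤ u) :
    u * realTruncExp n u ≤ (n + 1) * realTruncExp (n + 1) u := by
  unfold realTruncExp
  rw [Finset.sum_range_succ' _ (n + 1), mul_add, Finset.mul_sum, Finset.mul_sum]
  have h : ∑ i ∈ range (n + 1), u * (u ^ i / (Nat.factorial i : ℝ)) ≤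
      ∑ i ∈ range (n + 1), ((n : ℝ) + 1) * (u ^ (i + 1) / (Nat.factorial (i + 1) : ℝ)) := by
    refine Finset.sum_le_sum fun i hi => ?_
    have hi' : (i : ℝ) + 1 ≤ n + 1 := by
      exact_mod_cast Finset.mem_range.mp hi
    have hf : (0 : ℝ) < Nat.factorial i := by positivity
    have e : u * (u ^ i / (Nat.factorial i : ℝ)) =
        ((i : ℝ) + 1) * (u ^ (i + 1) / (Nat.factorial (i + 1) : ℝ)) := by
      rw [Nat.factorial_succ]; push_cast; field_simp; ring
    rw [e]
    gcongr
  have : 0 ≤ ((n : ℝ) + 1) * (u ^ 0 / (Nat.factorial 0 : ℝ)) := by positivity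
  linarith

lemma norm_truncExp_le (n : ℕ) (z : ℂ) : ‖truncExp n z‖ ≤ realTruncExp n ‖z‖ := by
  refine (norm_sum_le _ _).trans (le_of_eq (Finset.sum_congr rfl fun j _ => ?_))
  simp

/-- Chernoff bound for the tail of the exponential series. -/
lemma exp_sub_sum_le (n : ℕ) {u s : ℝ} (hu : 0 ≤ u) (hs : 1 ≤ s) :
    Real.exp u - ∑ j ∈ range n, u ^ j / (Nat.factorial j : ℝ) ≤ Real.exp (s * u) / s ^ n := by
  have hasSum (v : ℝ) : HasSum (fun m : ℕ => v ^ m / (Nat.factorial m : ℝ)) (Real.exp v) := by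
    rw [Real.exp_eq_exp_ℝ]
    exact NormedSpace.expSeries_div_hasSum_exp v
  have tail (v : ℝ) := (hasSum_nat_add_iff' n).mpr (hasSum v)
  have hs0 : 0 < s := by linarith
  rw [le_div_iff₀ (by positivity), mul_comm]
  have h1 := (tail u).mul_left (s ^ n)
  have h2 := tail (s * u)
  have h3 : 0 ≤ ∑ j ∈ range n, (s * u) ^ j / (Nat.factorial j : ℝ) :=
    Finset.sum_nonneg fun _ _ => by positivity
  refine (hasSum_le (fun m => ?_) h1 h2).trans (by linarith)
  rw [mul_pow, mul_div_assoc]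
  have : s ^ n ≤ s ^ (m + n) := pow_le_pow_right₀ hs (by omega)
  gcongr

lemma norm_exp_neg_mul_truncExp_sub_one_le (n : ℕ) (z : ℂ) {s : ℝ} (hs : 1 ≤ s) :
    ‖Complex.exp (-z) * truncExp n z - 1‖ ≤ Real.exp (s * ‖z‖ - z.re - n * Real.log s) := by
  have hs0 : 0 < s := by linarith
  have e : Complex.exp (-z) * truncExp n z - 1 =
      -(Complex.exp (-z) * (Complex.exp z - truncExp n z)) := by
    have : Complex.exp (-z) * Complex.exp z = 1 := by rw [← Complex.exp_add]; simp
    linear_combination this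
  have h := (Complex.norm_exp_sub_sum_le_exp_norm_sub_sum z (n + 1)).trans
    (exp_sub_sum_le (n + 1) (norm_nonneg z) hs)
  have hpow : Real.exp (s * ‖z‖) / s ^ (n + 1) ≤ Real.exp (s * ‖z‖) / s ^ n := by
    have := pow_le_pow_right₀ hs (Nat.le_succ n)
    gcongr
  have hexp : Real.exp (s * ‖z‖ - z.re - n * Real.log s) =
      Real.exp (-z.re) * (Real.exp (s * ‖z‖) / s ^ n) := by
    rw [← Real.exp_log (pow_pos hs0 n), Real.log_pow, ← Real.exp_sub, ← Real.exp_add]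
    congr 1; ring
  rw [e, norm_neg, norm_mul, Complex.norm_exp, Complex.neg_re, hexp]
  exact mul_le_mul_of_nonneg_left (h.trans hpow) (Real.exp_pos _).le

/-- The coefficient `∏_{i<k} 2x/(2N−2i−1)` of the `k`-th term of the reversed sum. -/
noncomputable def bulkCoeff (N : ℕ) (x : ℂ) (k : ℕ) : ℂ :=
  ∏ i ∈ range k, 2 * x / (2 * (N : ℂ) - 2 * i - 1)

lemma two_mul_sub_ne_zero (N i : ℕ) : 2 * (N : ℂ) - 2 * i - 1 ≠ 0 := by
  intro h
  have h' : (2 * (N : ℤ) - 2 * i - 1 : ℤ) = 0 := by exact_mod_cast h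
  omega

lemma factorial_ratio_eq_bulkCoeff (N : ℕ) (x : ℂ) {k : ℕ} (hk : k ≤ N) :
    (Nat.factorial N : ℂ) / (Nat.factorial (2 * N) : ℂ) *
      ((Nat.factorial (2 * (N - k)) : ℂ) / (Nat.factorial (N - k) : ℂ) * (4 * x) ^ k) =
      bulkCoeff N x k := by
  induction k with
  | zero =>
    have h1 : (Nat.factorial N : ℂ) ≠ 0 := by exact_mod_cast Nat.factorial_ne_zero _
    have h2 : (Nat.factorial (2 * N) : ℂ) ≠ 0 := by exact_mod_cast Nat.factorial_ne_zero _
    simp [bulkCoeff]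
    field_simp
  | succ k ih =>
    obtain ⟨m, rfl⟩ : ∃ m, N = k + 1 + m := ⟨N - (k + 1), by omega⟩
    have ih := ih (by omega)
    rw [bulkCoeff, Finset.prod_range_succ, ← bulkCoeff, ← ih]
    have e1 : k + 1 + m - (k + 1) = m := by omega
    have e2 : k + 1 + m - k = m + 1 := by omega
    have e3 : 2 * (m + 1) = 2 * m + 1 + 1 := by ring
    rw [e1, e2, e3, Nat.factorial_succ, Nat.factorial_succ, Nat.factorial_succ m]
    have hd : (2 * ((k + 1 + m : ℕ) : ℂ) - 2 * k - 1) = 2 * m + 1 := by push_cast; ring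
    rw [hd]
    have h1 : (Nat.factorial (2 * (k + 1 + m)) : ℂ) ≠ 0 := by
      exact_mod_cast Nat.factorial_ne_zero _
    have h2 : (Nat.factorial m : ℂ) ≠ 0 := by exact_mod_cast Nat.factorial_ne_zero _
    have h3 : (2 * m + 1 : ℂ) ≠ 0 := by exact_mod_cast Nat.succ_ne_zero (2 * m)
    have h4 : (m + 1 : ℂ) ≠ 0 := by exact_mod_cast Nat.succ_ne_zero m
    push_cast
    field_simp
    ring

lemma norm_bulkCoeff_succ (N : ℕ) (x : ℂ) {k : ℕ} (hk : k < N) :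
    ‖bulkCoeff N x (k + 1)‖ = ‖bulkCoeff N x k‖ * (2 * ‖x‖ / (2 * (N - (k + 1) : ℕ) + 1)) := by
  rw [bulkCoeff, Finset.prod_range_succ, ← bulkCoeff, norm_mul, norm_div, norm_mul]
  obtain ⟨m, rfl⟩ : ∃ m, N = k + 1 + m := ⟨N - (k + 1), by omega⟩
  have hd : (2 * ((k + 1 + m : ℕ) : ℂ) - 2 * k - 1) = ((2 * m + 1 : ℕ) : ℂ) := by
    push_cast; ring
  have e1 : k + 1 + m - (k + 1) = m := by omega
  rw [hd, e1, Complex.norm_natCast, Complex.norm_two]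
  push_cast
  rfl

lemma norm_bulkCoeff_le {N : ℕ} {x : ℂ} {p l : ℝ} (hl : l ≤ N)
    (hp : ‖x‖ ≤ p * (N - l)) (hp0 : 0 ≤ p) {k : ℕ} (hk : (k : ℝ) ≤ l) :
    ‖bulkCoeff N x k‖ ≤ p ^ k := by
  induction k with
  | zero => simp [bulkCoeff]
  | succ k ih =>
    push_cast at hk
    have hkN : k + 1 ≤ N := by exact_mod_cast hk.trans hl
    rw [norm_bulkCoeff_succ N x hkN, pow_succ]
    have hle : 2 * ‖x‖ / (2 * (N - (k + 1) : ℕ) + 1) ≤ p := by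
      rw [div_le_iff₀ (by positivity), Nat.cast_sub hkN]
      push_cast
      have : p * (N - l) ≤ p * (N - (k + 1)) := by gcongr
      nlinarith
    exact mul_le_mul (ih (by linarith)) hle (by positivity) (by positivity)

lemma norm_bulkCoeff_mul_antitone (N : ℕ) (x : ℂ) {k l : ℕ} (hkl : k ≤ l) (hl : l ≤ N) :
    ‖bulkCoeff N x l‖ * realTruncExp (2 * (N - l)) (2 * ‖x‖) ≤
      ‖bulkCoeff N x k‖ * realTruncExp (2 * (N - k)) (2 * ‖x‖) := by
  induction l, hkl using Nat.le_induction with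
  | base => rfl
  | succ l _ ih =>
    refine le_trans ?_ (ih (by omega))
    rw [norm_bulkCoeff_succ N x (by omega), mul_assoc]
    refine mul_le_mul_of_nonneg_left ?_ (norm_nonneg _)
    obtain ⟨m, rfl⟩ : ∃ m, N = l + 1 + m := ⟨N - (l + 1), by omega⟩
    have e1 : l + 1 + m - (l + 1) = m := by omega
    have e2 : 2 * (l + 1 + m - l) = 2 * m + 1 + 1 := by omega
    rw [e1, e2, div_mul_eq_mul_div, div_le_iff₀ (by positivity)]
    have hu : 0 ≤ 2 * ‖x‖ := by positivity
    have h1 := mul_realTruncExp_le (2 * m) hu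
    have h2 := realTruncExp_le_succ (2 * m + 1) hu
    push_cast at h1
    have : (0 : ℝ) ≤ 2 * m + 1 := by positivity
    nlinarith

lemma norm_term_le_of_le {N : ℕ} {x : ℂ} {k l : ℕ} (hkl : k ≤ l) (hl : l ≤ N) :
    ‖bulkCoeff N x l * (Complex.exp (-(2 * x)) * truncExp (2 * (N - l)) (2 * x))‖ ≤
      ‖bulkCoeff N x k‖ * Real.exp (2 * ‖x‖ - 2 * x.re) := by
  have hn : ‖2 * x‖ = 2 * ‖x‖ := by simp
  have h1 := norm_truncExp_le (2 * (N - l)) (2 * x)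
  rw [hn] at h1
  have h2 := norm_bulkCoeff_mul_antitone N x hkl hl
  have h3 := realTruncExp_le_exp (2 * (N - k)) (u := 2 * ‖x‖) (by positivity)
  have h4 : ‖Complex.exp (-(2 * x))‖ = Real.exp (-(2 * x.re)) := by
    rw [Complex.norm_exp]; simp
  rw [norm_mul, norm_mul, h4]
  calc _ = Real.exp (-(2 * x.re)) * (‖bulkCoeff N x l‖ * ‖truncExp (2 * (N - l)) (2 * x)‖) := by
        ring
    _ ≤ Real.exp (-(2 * x.re)) * (‖bulkCoeff N x k‖ * Real.exp (2 * ‖x‖)) := by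
        gcongr Real.exp _ * ?_
        refine (mul_le_mul_of_nonneg_left h1 (norm_nonneg _)).trans (h2.trans ?_)
        gcongr
    _ = _ := by
        rw [sub_eq_add_neg, Real.exp_add]; ring

lemma tendsto_bulkCoeff {x : ℕ → ℂ} {ρ : ℂ}
    (hx : Tendsto (fun N : ℕ => x N / N) atTop (nhds ρ)) (k : ℕ) :
    Tendsto (fun N => bulkCoeff N (x N) k) atTop (nhds (ρ ^ k)) := by
  have h (i : ℕ) : Tendsto (fun N : ℕ => 2 * x N / (2 * (N : ℂ) - 2 * i - 1)) atTop (nhds ρ) := by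
    have hinv : Tendsto (fun N : ℕ => ((N : ℂ))⁻¹) atTop (nhds 0) :=
      tendsto_inv_atTop_nhds_zero_nat (𝕜 := ℂ)
    have hden : Tendsto (fun N : ℕ => 2 - (2 * (i : ℂ) + 1) * ((N : ℂ))⁻¹) atTop (nhds 2) := by
      simpa using (hinv.const_mul (2 * (i : ℂ) + 1)).const_sub 2
    have := (hx.const_mul 2).div hden two_ne_zero
    rw [mul_div_cancel_left₀ _ (two_ne_zero' ℂ)] at this
    refine this.congr' ?_
    filter_upwards [eventually_gt_atTop 0] with N hN
    have hN' : (N : ℂ) ≠ 0 := by exact_mod_cast hN.ne'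
    have e : 2 - (2 * (i : ℂ) + 1) * ((N : ℂ))⁻¹ = (2 * (N : ℂ) - 2 * i - 1) / N := by
      field_simp; ring
    have := two_mul_sub_ne_zero N i
    simp only [Pi.div_apply]
    rw [e]
    field_simp
  simpa [bulkCoeff] using tendsto_finsetProd (range k) fun i _ => h i

lemma tendsto_bulk_sum {ρ : ℝ} (hρ0 : 0 ≤ ρ) (hρ1 : ρ < 1) {x : ℕ → ℂ}
    (hx : Tendsto (fun N : ℕ => x N / N) atTop (nhds (ρ : ℂ))) :
    Tendsto (fun N : ℕ => ∑ k ∈ range (N + 1),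
      bulkCoeff N (x N) k * (Complex.exp (-(2 * x N)) * truncExp (2 * (N - k)) (2 * x N)))
      atTop (nhds (((1 / (1 - ρ) : ℝ)) : ℂ)) := by
  have hnorm : Tendsto (fun N : ℕ => ‖x N‖ / N) atTop (nhds ρ) := by
    have := hx.norm
    simpa [abs_of_nonneg hρ0] using this
  have hre : Tendsto (fun N : ℕ => (x N).re / N) atTop (nhds ρ) := by
    have := (Complex.continuous_re.tendsto _).comp hx
    simpa [Function.comp_def, Complex.div_natCast_re] using this
  have hinv : Tendsto (fun N : ℕ => ((N : ℝ))⁻¹) atTop (nhds 0) :=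
    tendsto_inv_atTop_nhds_zero_nat (𝕜 := ℝ)
  obtain ⟨l, hl⟩ : ∃ l : ℝ, l = (1 - ρ) / 2 := ⟨_, rfl⟩
  obtain ⟨s, hs⟩ : ∃ s : ℝ, s = 1 + (1 - ρ) / 4 := ⟨_, rfl⟩
  have hl0 : 0 < l := by linarith
  have hl1 : l < 1 := by linarith
  have hs1 : 1 < s := by linarith
  obtain ⟨p, hp1, hp2⟩ : ∃ p, ρ / (1 - l) < p ∧ p < 1 :=
    exists_between (by rw [div_lt_one (by linarith)]; linarith)
  have hp0 : 0 < p := lt_of_le_of_lt (div_nonneg hρ0 (by linarith)) hp1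
  have hlogp : Real.log p < 0 := Real.log_neg hp0 hp2
  obtain ⟨η, hη⟩ : ∃ η : ℝ, η = -(l * Real.log p) / 2 := ⟨_, rfl⟩
  have hη0 : 0 < η := by nlinarith
  have hpη : p ≤ Real.exp (-η) := by
    rw [← Real.log_le_iff_le_exp hp0]
    nlinarith
  -- the truncated exponentials are uniformly close to the exponential for `k ≤ l * N`
  have hδ : Tendsto (fun N : ℕ => Real.exp (s * (2 * ‖x N‖) - 2 * (x N).re -
      2 * ((1 - l) * N) * Real.log s)) atTop (nhds 0) := by
    refine Real.tendsto_exp_atBot.comp ?_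
    have hlim : Tendsto (fun N : ℕ => s * (2 * (‖x N‖ / N)) - 2 * ((x N).re / N) -
        2 * (1 - l) * Real.log s) atTop
        (nhds (s * (2 * ρ) - 2 * ρ - 2 * (1 - l) * Real.log s)) :=
      (((hnorm.const_mul 2).const_mul s).sub (hre.const_mul 2)).sub_const _
    have hneg : s * (2 * ρ) - 2 * ρ - 2 * (1 - l) * Real.log s < 0 := by
      have h1 : 1 - s⁻¹ ≤ Real.log s := Real.one_sub_inv_le_log_of_pos (by linarith)
      have h2 : ρ * s < 1 - l := by subst hs hl; nlinarith
      have h3 : (s - 1) * ρ < (1 - l) * (1 - s⁻¹) := by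
        have : (1 - l) * (1 - s⁻¹) = (s - 1) * ((1 - l) / s) := by field_simp
        rw [this]
        refine mul_lt_mul_of_pos_left ?_ (by linarith)
        rwa [lt_div_iff₀ (by linarith)]
      have h4 : (1 - l) * (1 - s⁻¹) ≤ (1 - l) * Real.log s :=
        mul_le_mul_of_nonneg_left h1 (by linarith)
      linarith
    refine (tendsto_natCast_atTop_atTop.atTop_mul_neg hneg hlim).congr' ?_
    filter_upwards [eventually_gt_atTop 0] with N hN
    have hN' : (N : ℝ) ≠ 0 := by exact_mod_cast hN.ne'
    field_simp
  have hF (N k : ℕ) (hk : (k : ℝ) ≤ l * N) :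
      ‖Complex.exp (-(2 * x N)) * truncExp (2 * (N - k)) (2 * x N) - 1‖ ≤
        Real.exp (s * (2 * ‖x N‖) - 2 * (x N).re - 2 * ((1 - l) * N) * Real.log s) := by
    refine (norm_exp_neg_mul_truncExp_sub_one_le _ _ hs1.le).trans ?_
    have hkN : k ≤ N := by
      have : (k : ℝ) ≤ N := hk.trans (by nlinarith [Nat.cast_nonneg (α := ℝ) N])
      exact_mod_cast this
    rw [Real.exp_le_exp]
    push_cast [Nat.cast_sub hkN]
    have : 2 * ((1 - l) * N) * Real.log s ≤ 2 * (N - k) * Real.log s := by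
      have := Real.log_pos hs1
      gcongr
      linarith
    simp only [norm_mul, Complex.norm_two, Complex.mul_re, Complex.re_ofNat, Complex.im_ofNat,
      zero_mul, sub_zero]
    linarith
  have hbound : ∀ᶠ N : ℕ in atTop, ∀ k ≤ N,
      ‖bulkCoeff N (x N) k * (Complex.exp (-(2 * x N)) * truncExp (2 * (N - k)) (2 * x N))‖ ≤
        2 * Real.exp (-η) ^ k := by
    have hgap : ∀ᶠ N : ℕ in atTop,
        2 * (‖x N‖ / N) - 2 * ((x N).re / N) - Real.log p * (N : ℝ)⁻¹ < η := by
      have : Tendsto (fun N : ℕ => 2 * (‖x N‖ / N) - 2 * ((x N).re / N) -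
          Real.log p * (N : ℝ)⁻¹) atTop (nhds (2 * ρ - 2 * ρ - Real.log p * 0)) :=
        ((hnorm.const_mul 2).sub (hre.const_mul 2)).sub (hinv.const_mul _)
      exact this.eventually_lt_const (by linarith)
    have hratio : ∀ᶠ N : ℕ in atTop, ‖x N‖ / N < p * (1 - l) :=
      hnorm.eventually_lt_const (by rwa [div_lt_iff₀ (by linarith)] at hp1)
    filter_upwards [hgap, hratio, hδ.eventually_lt_const one_pos, eventually_gt_atTop 0]
      with N h1 h2 h3 hN k hkN
    have hN' : (0 : ℝ) < N := by exact_mod_cast hN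
    have hlN : l * N ≤ N := by nlinarith
    have hxN : ‖x N‖ ≤ p * (N - l * N) := by
      rw [div_lt_iff₀ hN'] at h2
      linarith
    rcases le_or_gt (k : ℝ) (l * N) with hk | hk
    · have hc := norm_bulkCoeff_le hlN hxN hp0.le hk
      have hf : ‖Complex.exp (-(2 * x N)) * truncExp (2 * (N - k)) (2 * x N)‖ ≤ 2 := by
        have := norm_le_norm_sub_add
          (Complex.exp (-(2 * x N)) * truncExp (2 * (N - k)) (2 * x N)) 1
        have h4 := hF N k hk
        rw [norm_one] at this
        linarith
      rw [norm_mul, mul_comm]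
      have : p ^ k ≤ Real.exp (-η) ^ k := by gcongr
      exact mul_le_mul hf (hc.trans this) (norm_nonneg _) (by norm_num)
    · have hfl : ((⌊l * N⌋₊ : ℕ) : ℝ) ≤ l * N := Nat.floor_le (by positivity)
      have hfk : ⌊l * N⌋₊ ≤ k := by exact_mod_cast (hfl.trans hk.le)
      refine (norm_term_le_of_le hfk hkN).trans ?_
      have hc := norm_bulkCoeff_le hlN hxN hp0.le hfl
      have hpow : p ^ ⌊l * N⌋₊ ≤ Real.exp ((l * N - 1) * Real.log p) := by
        rw [← Real.exp_log (pow_pos hp0 _), Real.log_pow, Real.exp_le_exp]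
        exact mul_le_mul_of_nonpos_right (Nat.sub_one_lt_floor _).le hlogp.le
      calc _ ≤ Real.exp ((l * N - 1) * Real.log p) * Real.exp (2 * ‖x N‖ - 2 * (x N).re) := by
            gcongr; exact hc.trans hpow
        _ ≤ Real.exp (-η) ^ k := by
            rw [← Real.exp_add, ← Real.exp_nat_mul, Real.exp_le_exp]
            have h5 : 2 * ‖x N‖ - 2 * (x N).re - Real.log p < η * N := by
              rw [← div_lt_iff₀ hN']
              have : (2 * ‖x N‖ - 2 * (x N).re - Real.log p) / N =
                  2 * (‖x N‖ / N) - 2 * ((x N).re / N) - Real.log p * (N : ℝ)⁻¹ := by ring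
              rwa [this]
            have h6 : (k : ℝ) * η ≤ N * η := by gcongr
            have h7 : l * N * Real.log p = -2 * (η * N) := by rw [hη]; ring
            nlinarith
        _ ≤ 2 * Real.exp (-η) ^ k := by
            have : 0 < Real.exp (-η) ^ k := by positivity
            linarith
  have hterm (k : ℕ) : Tendsto (fun N : ℕ => bulkCoeff N (x N) k *
      (Complex.exp (-(2 * x N)) * truncExp (2 * (N - k)) (2 * x N))) atTop
      (nhds ((ρ : ℂ) ^ k)) := by
    have hf : Tendsto (fun N : ℕ => Complex.exp (-(2 * x N)) * truncExp (2 * (N - k)) (2 * x N))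
        atTop (nhds 1) := by
      rw [tendsto_iff_norm_sub_tendsto_zero]
      refine squeeze_zero' (Eventually.of_forall fun _ => norm_nonneg _) ?_ hδ
      have hlt : Tendsto (fun N : ℕ => l * (N : ℝ)) atTop atTop :=
        tendsto_natCast_atTop_atTop.const_mul_atTop hl0
      filter_upwards [hlt.eventually_ge_atTop (k : ℝ)] with N hN using hF N k hN
    simpa using (tendsto_bulkCoeff hx k).mul hf
  have hsum : ∑' k : ℕ, (ρ : ℂ) ^ k = (((1 / (1 - ρ) : ℝ)) : ℂ) := by
    rw [tsum_geometric_of_norm_lt_one (by simpa [abs_of_nonneg hρ0] using hρ1)]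
    push_cast
    rw [one_div]
  rw [← hsum]
  have hsummable : Summable fun k : ℕ => 2 * Real.exp (-η) ^ k :=
    (summable_geometric_of_lt_one (Real.exp_pos _).le
      (by rw [Real.exp_lt_one_iff]; linarith)).mul_left 2
  have key := tendsto_tsum_of_dominated_convergence (𝓕 := atTop)
    (f := fun N k : ℕ => if k ∈ range (N + 1) then bulkCoeff N (x N) k *
      (Complex.exp (-(2 * x N)) * truncExp (2 * (N - k)) (2 * x N)) else 0)
    (g := fun k : ℕ => (ρ : ℂ) ^ k) hsummable
    (fun k => (hterm k).congr' (by
      filter_upwards [eventually_ge_atTop k] with N hN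
      rw [if_pos (Finset.mem_range.mpr (by omega))]))
    (by
      filter_upwards [hbound] with N hN k
      split_ifs with h
      · exact hN k (by have := Finset.mem_range.mp h; omega)
      · rw [norm_zero]; positivity)
  refine key.congr fun N => ?_
  rw [tsum_eq_sum (s := range (N + 1)) (fun k hk => if_neg hk)]
  exact Finset.sum_congr rfl fun k hk => if_pos hk

lemma tendsto_bulk_point_div (ρ y : ℝ) (c : ℂ) :
    Tendsto (fun N : ℕ => ((N : ℂ) * (ρ : ℂ) + (Real.sqrt N : ℝ) * (y : ℂ) + c) / N) atTop
      (nhds (ρ : ℂ)) := by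
  have hinv : Tendsto (fun N : ℕ => ((N : ℂ))⁻¹) atTop (nhds 0) :=
    tendsto_inv_atTop_nhds_zero_nat (𝕜 := ℂ)
  have hsq : Tendsto (fun N : ℕ => (((Real.sqrt N)⁻¹ : ℝ) : ℂ)) atTop (nhds 0) := by
    have h : Tendsto (fun N : ℕ => (Real.sqrt N)⁻¹) atTop (nhds 0) :=
      tendsto_inv_atTop_zero.comp (Real.tendsto_sqrt_atTop.comp tendsto_natCast_atTop_atTop)
    exact_mod_cast (Complex.continuous_ofReal.tendsto 0).comp h
  have := ((hsq.mul_const (y : ℂ)).const_add (ρ : ℂ)).add (hinv.const_mul c)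
  simp only [zero_mul, mul_zero, add_zero] at this
  refine this.congr' ?_
  filter_upwards [eventually_gt_atTop 0] with N hN
  have hN' : (N : ℂ) ≠ 0 := by exact_mod_cast hN.ne'
  have hs0 : ((Real.sqrt N : ℝ) : ℂ) ≠ 0 := by
    exact_mod_cast (Real.sqrt_pos.mpr (by exact_mod_cast hN)).ne'
  have hss : ((Real.sqrt N : ℝ) : ℂ) * ((Real.sqrt N : ℝ) : ℂ) = N := by
    rw [← Complex.ofReal_mul, Real.mul_self_sqrt (Nat.cast_nonneg N), Complex.ofReal_natCast]
  have e : (((Real.sqrt N)⁻¹ : ℝ) : ℂ) = ((Real.sqrt N : ℝ) : ℂ) / N := by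
    rw [← hss]; push_cast; field_simp
  rw [e]
  field_simp

/-- Bulk limit for class AII† (complex self-dual): with `x_N = Nρ + √N y + c` and
`0 ≤ ρ < 1`, `(N!/(2N)!) ∑_{j=0}^N ((2j)!/j!) (4x_N)^{N−j} e^{−2x_N} E_{2j}(2x_N)`
converges to `1/(1 − ρ)`. -/
theorem statement16 (ρ : ℝ) (hρ0 : 0 ≤ ρ) (hρ1 : ρ < 1) (y : ℝ) (c : ℂ) :
    Tendsto (fun N : ℕ =>
        ((Nat.factorial N : ℂ) / (Nat.factorial (2 * N) : ℂ)) *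
          ∑ j ∈ Finset.range (N + 1),
            ((Nat.factorial (2 * j) : ℂ) / (Nat.factorial j : ℂ)) *
              (4 * ((N : ℂ) * (ρ : ℂ) + (Real.sqrt N : ℝ) * (y : ℂ) + c)) ^ (N - j) *
              Complex.exp (-(2 * ((N : ℂ) * (ρ : ℂ) + (Real.sqrt N : ℝ) * (y : ℂ) + c))) *
              truncExp (2 * j) (2 * ((N : ℂ) * (ρ : ℂ) + (Real.sqrt N : ℝ) * (y : ℂ) + c)))
      atTop (nhds (((1 / (1 - ρ) : ℝ)) : ℂ)) := by
  refine (tendsto_bulk_sum hρ0 hρ1 (tendsto_bulk_point_div ρ y c)).congr fun N => ?_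
  rw [← Finset.sum_range_reflect, Finset.mul_sum]
  refine Finset.sum_congr rfl fun j hj => ?_
  have hj' : j ≤ N := by have := Finset.mem_range.mp hj; omega
  have e1 : N + 1 - 1 - j = N - j := by omega
  have e2 : N - (N - j) = j := by omega
  rw [e1, ← factorial_ratio_eq_bulkCoeff N _ (Nat.sub_le N j), e2]
  ring
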